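/- If the score function s(X,Y) is measurable and fixed (independent of the calibration and test data), and the pairs (X_1,Y_1),...,(X_{n+1},Y_{n+1}) are exchangeable, then with V_i = s(X_i,Y_i) and Q_{1-α} the ⌈(1-α)(n+1)⌉-th order statistic of V_1,...,V_n, the prediction set C(x) = {y : s(x,y) ≤ Q_{1-α}} satisfies P(Y_{n+1} ∈ C(X_{n+1})) ≥ 1 − α. -/

import Mathlib

open MeasureTheory

/-- The `k`-th smallest value (1-indexed) of a finite tuple of reals, `0` by default. -/
noncomputable def orderStat {n : ℕ} (v : Fin n → ℝ) (k : ℕ) : ℝ :=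
  ((Finset.univ.val.map v).sort (· ≤ ·)).getD (k - 1) 0

/-- Exchangeability: the joint law is invariant under permutations of the indices. -/
def Exchangeable {Ω : Type*} [MeasurableSpace Ω] (P : Measure Ω)
    {n : ℕ} {β : Type*} [MeasurableSpace β] (Z : Fin n → Ω → β) : Prop :=
  ∀ π : Equiv.Perm (Fin n),
    Measure.map (fun ω => fun i => Z (π i) ω) P = Measure.map (fun ω => fun i => Z i ω) P

/-- If the `k`-th smallest value lies strictly below `t`, then at least `k` values do. -/
theorem le_card_lt_of_orderStat_lt {n : ℕ} (v : Fin n → ℝ) {k : ℕ} (hk : 0 < k) (hkn : k ≤ n)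
    {t : ℝ} (h : orderStat v k < t) : k ≤ (Finset.univ.filter fun j => v j < t).card := by
  set l := (Finset.univ.val.map v).sort (· ≤ ·) with hl
  have hlen : l.length = n := by simp [hl]
  have hsorted : l.Pairwise (· ≤ ·) := Multiset.pairwise_sort _ _
  have hlast : l[k - 1]'(by omega) < t := by
    rwa [orderStat, ← hl, List.getD_eq_getElem _ _ (by omega)] at h
  have htake : (l.take k).countP (fun x => decide (x < t)) = k := by
    have hall : (l.take k).countP (fun x => decide (x < t)) = (l.take k).length := by
      rw [List.countP_eq_length]
      intro x hx
      obtain ⟨i, hi, rfl⟩ := List.getElem_of_mem hx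
      rw [List.length_take] at hi
      rw [List.getElem_take, decide_eq_true_eq]
      refine lt_of_le_of_lt ?_ hlast
      exact hsorted.sortedLE.getElem_le_getElem_of_le (by omega)
    rw [hall, List.length_take]
    omega
  have hcount : l.countP (fun x => decide (x < t))
      = (Finset.univ.filter fun j => v j < t).card := by
    rw [← Multiset.coe_countP, hl, Multiset.sort_eq, Multiset.countP_map]
    rfl
  rw [← hcount]
  calc k = (l.take k).countP (fun x => decide (x < t)) := htake.symm
    _ ≤ _ := (List.take_sublist k l).countP_le

/-- Among `m` reals, at least `k ≤ m` have fewer than `k` values strictly below them. -/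
theorem le_card_card_lt_lt {m : ℕ} (v : Fin m → ℝ) {k : ℕ} (hk : k ≤ m) :
    k ≤ (Finset.univ.filter fun i => (Finset.univ.filter fun j => v j < v i).card < k).card := by
  set σ := Tuple.sort v
  have hmono : Monotone (v ∘ σ) := Tuple.monotone_sort v
  have hsub : (Finset.univ : Finset (Fin k)).image (σ ∘ Fin.castLE hk) ⊆
      Finset.univ.filter fun i => (Finset.univ.filter fun j => v j < v i).card < k := by
    intro x hx
    obtain ⟨i, -, rfl⟩ := Finset.mem_image.1 hx
    rw [Finset.mem_filter]
    refine ⟨Finset.mem_univ _, ?_⟩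
    have hbelow : (Finset.univ.filter fun j => v j < v (σ (Fin.castLE hk i))) ⊆
        (Finset.Iio (Fin.castLE hk i)).image σ := by
      intro j hj
      rw [Finset.mem_filter] at hj
      refine Finset.mem_image.2 ⟨σ.symm j, Finset.mem_Iio.2 ?_, σ.apply_symm_apply j⟩
      refine hmono.reflect_lt ?_
      simpa using hj.2
    calc _ ≤ _ := Finset.card_le_card hbelow
      _ ≤ (Finset.Iio (Fin.castLE hk i)).card := Finset.card_image_le
      _ = i := by simp
      _ < k := i.2
  calc k = _ := by
        rw [Finset.card_image_of_injective _
          (σ.injective.comp (Fin.castLE_injective hk)), Finset.card_univ, Fintype.card_fin]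
    _ ≤ _ := Finset.card_le_card hsub

/-- Exchangeability is preserved by applying a fixed measurable map to each coordinate. -/
theorem Exchangeable.comp_measurable {Ω : Type*} [MeasurableSpace Ω] {P : Measure Ω}
    {m : ℕ} {β γ : Type*} [MeasurableSpace β] [MeasurableSpace γ] {Z : Fin m → Ω → β}
    (h : Exchangeable P Z) (hZ : ∀ i, Measurable (Z i)) {s : β → γ} (hs : Measurable s) :
    Exchangeable P (fun i ω => s (Z i ω)) := by
  intro π
  have hs' : Measurable fun z : Fin m → β => fun i => s (z i) :=
    measurable_pi_lambda _ fun i => hs.comp (measurable_pi_apply i)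
  have hπ := congrArg (Measure.map fun z : Fin m → β => fun i => s (z i)) (h π)
  rwa [Measure.map_map hs' (measurable_pi_lambda _ fun i => hZ (π i)),
    Measure.map_map hs' (measurable_pi_lambda _ hZ)] at hπ

theorem measurableSet_card_lt_lt {m : ℕ} (k : ℕ) (i : Fin m) :
    MeasurableSet {v : Fin m → ℝ | (Finset.univ.filter fun j => v j < v i).card < k} := by
  have hcard : Measurable fun v : Fin m → ℝ => (Finset.univ.filter fun j => v j < v i).card := by
    simp only [Finset.card_filter]
    refine Finset.measurable_sum _ fun j _ => Measurable.ite ?_ measurable_const measurable_const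
    exact measurableSet_lt (measurable_pi_apply j) (measurable_pi_apply i)
  exact hcard (measurableSet_Iio (a := k))

/-- For exchangeable scores, the probability that fewer than `k` scores lie strictly below a
given one does not depend on the chosen score. -/
theorem Exchangeable.measure_card_lt_lt_eq {Ω : Type*} [MeasurableSpace Ω] {P : Measure Ω}
    {m : ℕ} {V : Fin m → Ω → ℝ} (h : Exchangeable P V) (hV : ∀ i, Measurable (V i))
    (k : ℕ) (a b : Fin m) :
    P {ω | (Finset.univ.filter fun j => V j ω < V a ω).card < k}
      = P {ω | (Finset.univ.filter fun j => V j ω < V b ω).card < k} := by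
  have hπ := congrArg (fun μ : Measure (Fin m → ℝ) =>
    μ {v | (Finset.univ.filter fun j => v j < v b).card < k}) (h (Equiv.swap a b))
  rw [Measure.map_apply (measurable_pi_lambda _ fun i => hV _) (measurableSet_card_lt_lt k b),
    Measure.map_apply (measurable_pi_lambda _ hV) (measurableSet_card_lt_lt k b)] at hπ
  refine Eq.trans (congrArg P ?_) hπ
  ext ω
  simp only [Set.mem_ofPred_eq, Set.mem_preimage, Equiv.swap_apply_right]
  rw [← Finset.card_map (Equiv.swap a b).toEmbedding (s := Finset.univ.filter fun j =>
    V (Equiv.swap a b j) ω < V a ω)]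
  refine iff_of_eq (congrArg (fun c : Finset (Fin m) => c.card < k) ?_)
  ext j
  simp [Finset.mem_map_equiv]

/-- The rank of one of `m` exchangeable scores is stochastically at most uniform. -/
theorem Exchangeable.le_mul_measure_card_lt_lt {Ω : Type*} [MeasurableSpace Ω] {P : Measure Ω}
    [IsProbabilityMeasure P] {m : ℕ} {V : Fin m → Ω → ℝ} (h : Exchangeable P V)
    (hV : ∀ i, Measurable (V i)) {k : ℕ} (hk : k ≤ m) (a : Fin m) :
    (k : ENNReal) ≤ m * P {ω | (Finset.univ.filter fun j => V j ω < V a ω).card < k} := by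
  set A : Fin m → Set Ω := fun i => {ω | (Finset.univ.filter fun j => V j ω < V i ω).card < k}
    with hA
  have hAm : ∀ i, MeasurableSet (A i) := fun i =>
    (measurable_pi_lambda (fun ω j => V j ω) hV) (measurableSet_card_lt_lt k i)
  calc (k : ENNReal) = ∫⁻ _, (k : ENNReal) ∂P := by simp
    _ ≤ ∫⁻ ω, ∑ i, (A i).indicator 1 ω ∂P := by
        refine lintegral_mono fun ω => ?_
        have hω : ∑ i, (A i).indicator (1 : Ω → ENNReal) ω
            = ((Finset.univ.filter fun i =>
              (Finset.univ.filter fun j => V j ω < V i ω).card < k).card : ENNReal) := by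
          simp [Set.indicator_apply, hA]
        rw [hω]
        exact Nat.cast_le.2 (le_card_card_lt_lt (fun i => V i ω) hk)
    _ = ∑ i, P (A i) := by
        rw [lintegral_finsetSum _ fun i _ => measurable_one.indicator (hAm i)]
        simp only [lintegral_indicator_one (hAm _)]
    _ = m * P (A a) := by
        rw [Finset.sum_congr rfl fun i _ => h.measure_card_lt_lt_eq hV k i a]
        simp [hA]

/-- Validity of split conformal prediction with a general fixed measurable
non-conformity score: with `V_i = s(X_i, Y_i)` and `Q_{1-α}` the
`⌈(1-α)(n+1)⌉`-th order statistic of `V_1, …, V_n` (interpreted as `+∞` if the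
index exceeds `n`, in which case coverage is trivial),
`P(Y_{n+1} ∈ C(X_{n+1})) = P(V_{n+1} ≤ Q_{1-α}) ≥ 1 − α`. -/
theorem split_conformal_validity
    {Ω 𝒳 𝒴 : Type*} [MeasurableSpace Ω] [MeasurableSpace 𝒳] [MeasurableSpace 𝒴]
    (P : Measure Ω) [IsProbabilityMeasure P] (n : ℕ) (hn : 0 < n)
    (α : ℝ) (hα0 : 0 < α) (hα1 : α < 1)
    (X : Fin (n + 1) → Ω → 𝒳) (Y : Fin (n + 1) → Ω → 𝒴)
    (hmeas : ∀ i, Measurable (fun ω => (X i ω, Y i ω)))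
    (hexch : Exchangeable P (fun i ω => (X i ω, Y i ω)))
    (s : 𝒳 × 𝒴 → ℝ) (hs : Measurable s) :
    P {ω | ⌈(1 - α) * (n + 1)⌉₊ ≤ n →
        s (X (Fin.last n) ω, Y (Fin.last n) ω) ≤
          orderStat (fun i : Fin n => s (X i.castSucc ω, Y i.castSucc ω))
            ⌈(1 - α) * (n + 1)⌉₊}
      ≥ ENNReal.ofReal (1 - α) := by
  set k := ⌈(1 - α) * (n + 1)⌉₊ with hk
  have hkpos : 0 < k := Nat.ceil_pos.2 (mul_pos (by linarith) (by positivity))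
  have hkle : k ≤ n + 1 := by
    refine Nat.ceil_le.2 ?_
    push_cast
    nlinarith [(n.cast_nonneg : (0 : ℝ) ≤ n)]
  have hV : ∀ i, Measurable fun ω => s (X i ω, Y i ω) := fun i => hs.comp (hmeas i)
  have hrank := (hexch.comp_measurable hmeas hs).le_mul_measure_card_lt_lt hV hkle (Fin.last n)
  refine ge_iff_le.2 (le_trans ?_ (measure_mono (μ := P) (s := {ω | (Finset.univ.filter fun j =>
    s (X j ω, Y j ω) < s (X (Fin.last n) ω, Y (Fin.last n) ω)).card < k}) ?_))
  · rw [← ENNReal.mul_le_mul_iff_right (a := ((n + 1 : ℕ) : ENNReal)) (by simp)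
      (ENNReal.natCast_ne_top _)]
    refine le_trans ?_ hrank
    rw [← ENNReal.ofReal_natCast (n + 1), ← ENNReal.ofReal_natCast k,
      ← ENNReal.ofReal_mul (by positivity)]
    refine ENNReal.ofReal_le_ofReal ?_
    push_cast
    rw [mul_comm]
    exact Nat.le_ceil _
  · intro ω hω hkn
    by_contra! hlt
    have hcard := le_card_lt_of_orderStat_lt _ hkpos hkn hlt
    refine absurd (lt_of_le_of_lt (hcard.trans ?_) hω) (lt_irrefl k)
    rw [← Finset.card_map Fin.castSuccEmb]
    refine Finset.card_le_card fun x hx => ?_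
    obtain ⟨j, hj, rfl⟩ := Finset.mem_map.1 hx
    simpa using hj
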